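/- arXiv:1602.07328 — 2 statements merged into one kernel-verified Lean document; each statement's English description precedes it below -/
import Mathlib

section
/- Let (X,ω) be a strong left Frobenius pair in an abelian category C. Then the following conditions are equivalent: (a) Proj(C) ⊆ ω and Inj(C) ⊆ X^∧; (b) (ω, X^∧) is an X^∧-cotorsion pair in C with ω resolving in C and X^∧ coresolving in C; (c) (X, ω^∧) is an X^∧-cotorsion pair in C with X resolving in C and ω^∧ coresolving in C. -/
/-!
Common definitions for Auslander–Buchweitz approximation theory in abelian
categories, following Becerril–Mendoza–Pérez–Santiago.
-/

open CategoryTheory CategoryTheory.Limits ZeroObject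

universe w v u

namespace ABFormal

variable {C : Type u} [Category.{v} C] [Abelian C] [CategoryTheory.HasExt.{w} C]

/-- `0 → A → B → C' → 0` is a short exact sequence in `C`. -/
def IsShortExactSeq {A B C' : C} (f : A ⟶ B) (g : B ⟶ C') : Prop :=
  ∃ w : f ≫ g = 0, (ShortComplex.mk f g w).ShortExact

/-- `ωω` is `XX`-injective: `Ext^i(X, W) = 0` for all `X ∈ XX`, `W ∈ ωω` and `i > 0`. -/
def IsRelInjective (XX ωω : Set C) : Prop :=
  ∀ W ∈ ωω, ∀ X ∈ XX, ∀ i : ℕ, 0 < i → Subsingleton (Abelian.Ext.{w} X W i)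

/-- `ωω` is `XX`-projective: `Ext^i(W, X) = 0` for all `X ∈ XX`, `W ∈ ωω` and `i > 0`. -/
def IsRelProjective (XX ωω : Set C) : Prop :=
  ∀ W ∈ ωω, ∀ X ∈ XX, ∀ i : ℕ, 0 < i → Subsingleton (Abelian.Ext.{w} W X i)

/-- `ωω` is a relative cogenerator in `XX`. -/
def IsRelCogenerator (XX ωω : Set C) : Prop :=
  ωω ⊆ XX ∧ ∀ X ∈ XX, ∃ (W X' : C) (i : X ⟶ W) (p : W ⟶ X'),
    W ∈ ωω ∧ X' ∈ XX ∧ IsShortExactSeq i p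

/-- `ωω` is a relative generator in `XX`. -/
def IsRelGenerator (XX ωω : Set C) : Prop :=
  ωω ⊆ XX ∧ ∀ X ∈ XX, ∃ (X' W : C) (i : X' ⟶ W) (p : W ⟶ X),
    W ∈ ωω ∧ X' ∈ XX ∧ IsShortExactSeq i p

/-- `id_XX(M) ≤ n` : `Ext^j(X, M) = 0` for all `X ∈ XX` and `j > n`. -/
def relInjDimLE (XX : Set C) (M : C) (n : ℕ) : Prop :=
  ∀ X ∈ XX, ∀ j : ℕ, n < j → Subsingleton (Abelian.Ext.{w} X M j)

/-- The relative injective dimension `id_XX(M) : ℕ∞`. -/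
noncomputable def relInjDim (XX : Set C) (M : C) : ℕ∞ :=
  sInf {m : ℕ∞ | ∃ n : ℕ, m = (n : ℕ∞) ∧ relInjDimLE XX M n}

/-- `pd_XX(M) ≤ n` : `Ext^j(M, X) = 0` for all `X ∈ XX` and `j > n`. -/
def relProjDimLE (XX : Set C) (M : C) (n : ℕ) : Prop :=
  ∀ X ∈ XX, ∀ j : ℕ, n < j → Subsingleton (Abelian.Ext.{w} M X j)

/-- The relative projective dimension `pd_XX(M) : ℕ∞`. -/
noncomputable def relProjDim (XX : Set C) (M : C) : ℕ∞ :=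
  sInf {m : ℕ∞ | ∃ n : ℕ, m = (n : ℕ∞) ∧ relProjDimLE XX M n}

/-- There is an exact sequence `0 → X_n → ⋯ → X_0 → M → 0` with all `X_i ∈ XX`
(a resolution of length `n`). -/
inductive HasResolutionLength (XX : Set C) : ℕ → C → Prop
  | zero {M X : C} (hX : X ∈ XX) (e : X ≅ M) : HasResolutionLength XX 0 M
  | succ {n : ℕ} {M : C} (K X : C) (hX : X ∈ XX)
      (i : K ⟶ X) (p : X ⟶ M) (hse : IsShortExactSeq i p)
      (hK : HasResolutionLength XX n K) : HasResolutionLength XX (n + 1) M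

/-- The `XX`-resolution dimension `resdim_XX(M) : ℕ∞`. -/
noncomputable def resDim (XX : Set C) (M : C) : ℕ∞ :=
  sInf {m : ℕ∞ | ∃ n : ℕ, m = (n : ℕ∞) ∧ HasResolutionLength XX n M}

/-- `XX^∧`, the class of objects with a finite `XX`-resolution. -/
def resHat (XX : Set C) : Set C :=
  {M | ∃ n : ℕ, HasResolutionLength XX n M}

/-- There is an exact sequence `0 → M → X^0 → ⋯ → X^n → 0` with all `X^i ∈ XX`
(a coresolution of length `n`). -/
inductive HasCoresolutionLength (XX : Set C) : ℕ → C → Prop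
  | zero {M X : C} (hX : X ∈ XX) (e : M ≅ X) : HasCoresolutionLength XX 0 M
  | succ {n : ℕ} {M : C} (X Q : C) (hX : X ∈ XX)
      (i : M ⟶ X) (p : X ⟶ Q) (hse : IsShortExactSeq i p)
      (hQ : HasCoresolutionLength XX n Q) : HasCoresolutionLength XX (n + 1) M

/-- The `XX`-coresolution dimension `coresdim_XX(M) : ℕ∞`. -/
noncomputable def coresDim (XX : Set C) (M : C) : ℕ∞ :=
  sInf {m : ℕ∞ | ∃ n : ℕ, m = (n : ℕ∞) ∧ HasCoresolutionLength XX n M}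

/-- `XX^∨`, the class of objects with a finite `XX`-coresolution. -/
def coresVee (XX : Set C) : Set C :=
  {M | ∃ n : ℕ, HasCoresolutionLength XX n M}

/-- `IsSyzygyOf XX n M K` : there is an exact sequence
`0 → K → X_{n-1} → ⋯ → X_0 → M → 0` with all `X_i ∈ XX`. -/
inductive IsSyzygyOf (XX : Set C) : ℕ → C → C → Prop
  | zero {M K : C} (e : K ≅ M) : IsSyzygyOf XX 0 M K
  | succ {n : ℕ} {M : C} (K X L : C) (hX : X ∈ XX)
      (i : K ⟶ X) (p : X ⟶ L) (hse : IsShortExactSeq i p)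
      (hL : IsSyzygyOf XX n M L) : IsSyzygyOf XX (n + 1) M K

/-- `XX^⊥ = {N | Ext^i(X, N) = 0 for all X ∈ XX, i > 0}`. -/
def rightPerp (XX : Set C) : Set C :=
  {N | ∀ X ∈ XX, ∀ i : ℕ, 0 < i → Subsingleton (Abelian.Ext.{w} X N i)}

/-- `XX^{⊥₁} = {N | Ext^1(X, N) = 0 for all X ∈ XX}`. -/
def rightPerp1 (XX : Set C) : Set C :=
  {N | ∀ X ∈ XX, Subsingleton (Abelian.Ext.{w} X N 1)}

/-- `^⊥XX = {N | Ext^i(N, X) = 0 for all X ∈ XX, i > 0}`. -/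
def leftPerp (XX : Set C) : Set C :=
  {N | ∀ X ∈ XX, ∀ i : ℕ, 0 < i → Subsingleton (Abelian.Ext.{w} N X i)}

/-- `^{⊥₁}XX = {N | Ext^1(N, X) = 0 for all X ∈ XX}`. -/
def leftPerp1 (XX : Set C) : Set C :=
  {N | ∀ X ∈ XX, Subsingleton (Abelian.Ext.{w} N X 1)}

/-- Closed under extensions. -/
def ClosedUnderExtensions (XX : Set C) : Prop :=
  ∀ ⦃A B C' : C⦄ (f : A ⟶ B) (g : B ⟶ C'), IsShortExactSeq f g →
    A ∈ XX → C' ∈ XX → B ∈ XX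

/-- Closed under kernels of epimorphisms between objects of the class. -/
def ClosedUnderKernelsOfEpis (XX : Set C) : Prop :=
  ∀ ⦃A B C' : C⦄ (f : A ⟶ B) (g : B ⟶ C'), IsShortExactSeq f g →
    B ∈ XX → C' ∈ XX → A ∈ XX

/-- Closed under cokernels of monomorphisms between objects of the class. -/
def ClosedUnderCokernelsOfMonos (XX : Set C) : Prop :=
  ∀ ⦃A B C' : C⦄ (f : A ⟶ B) (g : B ⟶ C'), IsShortExactSeq f g →
    A ∈ XX → B ∈ XX → C' ∈ XX

/-- Closed under direct summands (retracts) in `C`. -/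
def ClosedUnderSummands (XX : Set C) : Prop :=
  ∀ ⦃X A : C⦄, X ∈ XX → ∀ (s : A ⟶ X) (r : X ⟶ A), s ≫ r = 𝟙 A → A ∈ XX

/-- Pre-resolving class: closed under extensions and kernels of epimorphisms. -/
def IsPreresolving (XX : Set C) : Prop :=
  ClosedUnderExtensions XX ∧ ClosedUnderKernelsOfEpis XX

/-- Pre-coresolving class: closed under extensions and cokernels of monomorphisms. -/
def IsPrecoresolving (XX : Set C) : Prop :=
  ClosedUnderExtensions XX ∧ ClosedUnderCokernelsOfMonos XX

/-- Left thick class. -/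
def IsLeftThick (XX : Set C) : Prop :=
  IsPreresolving XX ∧ ClosedUnderSummands XX

/-- Right thick class. -/
def IsRightThick (XX : Set C) : Prop :=
  IsPrecoresolving XX ∧ ClosedUnderSummands XX

/-- Thick class. -/
def IsThickClass (XX : Set C) : Prop :=
  IsLeftThick XX ∧ IsRightThick XX

/-- The smallest thick class of `C` containing `S`. -/
def thickClosure (S : Set C) : Set C :=
  ⋂₀ {T : Set C | IsThickClass T ∧ S ⊆ T}

/-- The class of projective objects of `C`. -/
def ProjClass (C : Type u) [Category.{v} C] : Set C := {P | Projective P}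

/-- The class of injective objects of `C`. -/
def InjClass (C : Type u) [Category.{v} C] : Set C := {I | Injective I}

/-- Resolving class in `C`: pre-resolving and containing all projectives. -/
def IsResolvingClass (XX : Set C) : Prop :=
  IsPreresolving XX ∧ ProjClass C ⊆ XX

/-- Coresolving class in `C`: pre-coresolving and containing all injectives. -/
def IsCoresolvingClass (XX : Set C) : Prop :=
  IsPrecoresolving XX ∧ InjClass C ⊆ XX

/-- A left Frobenius pair `(XX, ωω)` in `C`. -/
structure LeftFrobeniusPair (XX ωω : Set C) : Prop where
  leftThick : IsLeftThick XX
  relInj : IsRelInjective XX ωω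
  relCogen : IsRelCogenerator XX ωω
  summands : ClosedUnderSummands ωω

/-- A strong left Frobenius pair `(XX, ωω)` in `C`. -/
structure StrongLeftFrobeniusPair (XX ωω : Set C) extends LeftFrobeniusPair XX ωω : Prop where
  relProj : IsRelProjective XX ωω
  relGen : IsRelGenerator XX ωω

/-- A right Frobenius pair `(νν, YY)` in `C`. -/
structure RightFrobeniusPair (νν YY : Set C) : Prop where
  rightThick : IsRightThick YY
  relProj : IsRelProjective YY νν
  relGen : IsRelGenerator YY νν
  summands : ClosedUnderSummands νν

/-- `φ : X ⟶ M` is an `XX`-precover of `M`. -/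
def IsPrecover (XX : Set C) {X M : C} (φ : X ⟶ M) : Prop :=
  X ∈ XX ∧ ∀ (X' : C), X' ∈ XX → ∀ f : X' ⟶ M, ∃ h : X' ⟶ X, h ≫ φ = f

/-- `φ : M ⟶ Y` is an `XX`-preenvelope of `M`. -/
def IsPreenvelope (XX : Set C) {M Y : C} (φ : M ⟶ Y) : Prop :=
  Y ∈ XX ∧ ∀ (Y' : C), Y' ∈ XX → ∀ f : M ⟶ Y', ∃ h : Y ⟶ Y', φ ≫ h = f

/-- A left `S`-cotorsion pair `(F, G)` in `C`. -/
def IsLeftCotorsionPair (S F G : Set C) : Prop :=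
  F ⊆ S ∧ G ⊆ S ∧
  F = {A | A ∈ S ∧ ∀ G' ∈ G, Subsingleton (Abelian.Ext.{w} A G' 1)} ∧
  ∀ s ∈ S, ∃ (G' F' : C) (i : G' ⟶ F') (p : F' ⟶ s),
    G' ∈ G ∧ F' ∈ F ∧ IsShortExactSeq i p

/-- A right `S`-cotorsion pair `(F, G)` in `C`. -/
def IsRightCotorsionPair (S F G : Set C) : Prop :=
  F ⊆ S ∧ G ⊆ S ∧
  G = {A | A ∈ S ∧ ∀ F' ∈ F, Subsingleton (Abelian.Ext.{w} F' A 1)} ∧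
  ∀ s ∈ S, ∃ (G' F' : C) (i : s ⟶ G') (p : G' ⟶ F'),
    G' ∈ G ∧ F' ∈ F ∧ IsShortExactSeq i p

/-- An `S`-cotorsion pair `(F, G)` in `C`. -/
def IsCotorsionPair (S F G : Set C) : Prop :=
  IsLeftCotorsionPair S F G ∧ IsRightCotorsionPair S F G

/-- A left weak AB context `(AA, BB)` in `C`. -/
structure LeftWeakABContext (AA BB : Set C) : Prop where
  frob : LeftFrobeniusPair AA (AA ∩ BB)
  rightThick : IsRightThick BB
  sub : BB ⊆ resHat AA

section ShortExact

variable {𝒜 : Type u} [Category.{v} 𝒜] [Abelian 𝒜]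

theorem IsShortExactSeq.of_lift {A B D : 𝒜} {f : A ⟶ B} {g : B ⟶ D} [Mono f] [Epi g]
    (w : f ≫ g = 0)
    (h : ∀ (T : 𝒜) (k : T ⟶ B), k ≫ g = 0 → ∃ l : T ⟶ A, l ≫ f = k) :
    IsShortExactSeq f g :=
  ⟨w, .mk' (ShortComplex.exact_of_f_is_kernel _
    (KernelFork.IsLimit.ofι' f w fun {T} k hk => ⟨(h T k hk).choose, (h T k hk).choose_spec⟩))
    ‹_› ‹_›⟩

theorem IsShortExactSeq.of_desc {A B D : 𝒜} {f : A ⟶ B} {g : B ⟶ D} [Mono f] [Epi g]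
    (w : f ≫ g = 0)
    (h : ∀ (T : 𝒜) (k : B ⟶ T), f ≫ k = 0 → ∃ l : D ⟶ T, g ≫ l = k) :
    IsShortExactSeq f g :=
  ⟨w, .mk' (ShortComplex.exact_of_g_is_cokernel _
    (CokernelCofork.IsColimit.ofπ' g w fun {T} k hk => ⟨(h T k hk).choose, (h T k hk).choose_spec⟩))
    ‹_› ‹_›⟩

namespace IsShortExactSeq

theorem comp_eq_zero {A B D : 𝒜} {f : A ⟶ B} {g : B ⟶ D} (h : IsShortExactSeq f g) :
    f ≫ g = 0 := h.choose

theorem mono {A B D : 𝒜} {f : A ⟶ B} {g : B ⟶ D} (h : IsShortExactSeq f g) : Mono f :=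
  h.choose_spec.mono_f

theorem epi {A B D : 𝒜} {f : A ⟶ B} {g : B ⟶ D} (h : IsShortExactSeq f g) : Epi g :=
  h.choose_spec.epi_g

theorem exists_lift {A B D : 𝒜} {f : A ⟶ B} {g : B ⟶ D} (h : IsShortExactSeq f g)
    {T : 𝒜} (k : T ⟶ B) (hk : k ≫ g = 0) : ∃ l : T ⟶ A, l ≫ f = k :=
  have := h.mono
  ⟨h.choose_spec.exact.lift k hk, h.choose_spec.exact.lift_f k hk⟩

theorem exists_desc {A B D : 𝒜} {f : A ⟶ B} {g : B ⟶ D} (h : IsShortExactSeq f g)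
    {T : 𝒜} (k : B ⟶ T) (hk : f ≫ k = 0) : ∃ l : D ⟶ T, g ≫ l = k :=
  have := h.epi
  ⟨h.choose_spec.exact.desc k hk, h.choose_spec.exact.g_desc k hk⟩

theorem of_isPullback {E B X D K : 𝒜} {p : E ⟶ B} {q : E ⟶ X} {g : B ⟶ D} {h : X ⟶ D}
    {k : K ⟶ X} (sq : IsPullback p q g h) (hse : IsShortExactSeq k h) :
    ∃ k' : K ⟶ E, IsShortExactSeq k' p ∧ k' ≫ q = k := by
  have := hse.mono
  have := hse.epi
  have : Epi p := Abelian.epi_fst_of_isLimit g h sq.isLimit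
  have hq : sq.lift 0 k (by simp [hse.comp_eq_zero]) ≫ q = k := sq.lift_snd _ _ _
  have : Mono (sq.lift 0 k (by simp [hse.comp_eq_zero])) :=
    mono_of_mono_fac hq
  refine ⟨sq.lift 0 k _, of_lift (sq.lift_fst _ _ _) ?_, hq⟩
  intro T t ht
  obtain ⟨l, hl⟩ := hse.exists_lift (t ≫ q) (by
    rw [Category.assoc, ← sq.w, ← Category.assoc, ht, zero_comp])
  refine ⟨l, sq.hom_ext ?_ ?_⟩
  · simp [ht]
  · simp [hl]

theorem of_isPushout {K X Y E M : 𝒜} {i : K ⟶ Y} {j : K ⟶ X} {a : Y ⟶ E} {b : X ⟶ E}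
    {p : Y ⟶ M} (sq : IsPushout i j a b) (hse : IsShortExactSeq i p) :
    ∃ p' : E ⟶ M, IsShortExactSeq b p' ∧ a ≫ p' = p := by
  have := hse.mono
  have := hse.epi
  have : Mono b := Abelian.mono_inr_of_isColimit i j sq.isColimit
  have ha : a ≫ sq.desc p 0 (by simp [hse.comp_eq_zero]) = p := sq.inl_desc _ _ _
  have : Epi (sq.desc p 0 (by simp [hse.comp_eq_zero])) := epi_of_epi_fac ha
  refine ⟨sq.desc p 0 _, of_desc (sq.inr_desc _ _ _) ?_, ha⟩
  intro T t ht
  obtain ⟨l, hl⟩ := hse.exists_desc (a ≫ t) (by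
    rw [← Category.assoc, sq.w, Category.assoc, ht, comp_zero])
  refine ⟨l, sq.hom_ext ?_ ?_⟩
  · simp [hl]
  · simp [ht]

/-- Pulling back a short exact sequence along the epimorphism of another one. -/
theorem exists_pullback {A B D K X : 𝒜} {f : A ⟶ B} {g : B ⟶ D} {k : K ⟶ X} {h : X ⟶ D}
    (hB : IsShortExactSeq f g) (hX : IsShortExactSeq k h) :
    ∃ (E : 𝒜) (k' : K ⟶ E) (p : E ⟶ B) (f' : A ⟶ E) (q : E ⟶ X),
      IsShortExactSeq k' p ∧ IsShortExactSeq f' q := by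
  have sq := IsPullback.of_hasPullback g h
  obtain ⟨k', hk', -⟩ := of_isPullback sq hX
  obtain ⟨f', hf', -⟩ := of_isPullback sq.flip hB
  exact ⟨_, k', _, f', _, hk', hf'⟩

/-- Pushing out a short exact sequence along the monomorphism of another one. -/
theorem exists_pushout {K Y M X N : 𝒜} {i : K ⟶ Y} {p : Y ⟶ M} {j : K ⟶ X} {q : X ⟶ N}
    (hY : IsShortExactSeq i p) (hX : IsShortExactSeq j q) :
    ∃ (E : 𝒜) (b : X ⟶ E) (p' : E ⟶ M) (a : Y ⟶ E) (q' : E ⟶ N),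
      IsShortExactSeq b p' ∧ IsShortExactSeq a q' := by
  have sq := IsPushout.of_hasPushout i j
  obtain ⟨p', hp', -⟩ := of_isPushout sq hY
  obtain ⟨q', hq', -⟩ := of_isPushout sq.flip hX
  exact ⟨_, _, p', _, q', hp', hq'⟩

/-- The kernel of a composite of epimorphisms is an extension of their kernels. -/
theorem exists_kernel_comp {K P Q L R : 𝒜} {a : K ⟶ P} {p : P ⟶ Q} {b : L ⟶ Q} {q : Q ⟶ R}
    (hp : IsShortExactSeq a p) (hq : IsShortExactSeq b q) :
    ∃ (E : 𝒜) (c : K ⟶ E) (r : E ⟶ L) (i : E ⟶ P),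
      IsShortExactSeq c r ∧ IsShortExactSeq i (p ≫ q) := by
  have sq := IsPullback.of_hasPullback b p
  obtain ⟨c, hc, -⟩ := of_isPullback sq hp
  have := hq.mono
  have := hp.epi
  have := hq.epi
  refine ⟨_, c, _, pullback.snd b p, hc, of_lift ?_ ?_⟩
  · rw [← Category.assoc, ← sq.w, Category.assoc, hq.comp_eq_zero, comp_zero]
  · intro T k hk
    obtain ⟨l, hl⟩ := hq.exists_lift (k ≫ p) (by simpa using hk)
    exact ⟨sq.lift l k hl, sq.lift_snd _ _ _⟩

/-- The cokernel of a composite of monomorphisms is an extension of their cokernels. -/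
theorem exists_cokernel_comp {A B D E F : 𝒜} {a : A ⟶ B} {c : B ⟶ D} {b : B ⟶ E} {e : E ⟶ F}
    (ha : IsShortExactSeq a c) (hb : IsShortExactSeq b e) :
    ∃ (Z : 𝒜) (i : D ⟶ Z) (r : Z ⟶ F) (p : E ⟶ Z),
      IsShortExactSeq i r ∧ IsShortExactSeq (a ≫ b) p := by
  have sq := IsPushout.of_hasPushout b c
  obtain ⟨r, hr, -⟩ := of_isPushout sq hb
  have := ha.epi
  have := ha.mono
  have := hb.mono
  refine ⟨_, _, r, pushout.inl b c, hr, of_desc ?_ ?_⟩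
  · rw [Category.assoc, sq.w, ← Category.assoc, ha.comp_eq_zero, zero_comp]
  · intro T k hk
    obtain ⟨l, hl⟩ := ha.exists_desc (b ≫ k) (by simpa using hk)
    exact ⟨sq.desc k l hl.symm, sq.inl_desc _ _ _⟩

theorem of_zero_left (M : 𝒜) : IsShortExactSeq (0 : (0 : 𝒜) ⟶ M) (𝟙 M) :=
  of_lift (by simp) fun _ k hk => ⟨0, by simpa using hk.symm⟩

theorem of_zero_right (M : 𝒜) : IsShortExactSeq (𝟙 M) (0 : M ⟶ (0 : 𝒜)) :=
  of_desc (by simp) fun _ k hk => ⟨0, by simpa using hk.symm⟩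

theorem exists_section_of_retraction {A B D : 𝒜} {f : A ⟶ B} {g : B ⟶ D}
    (h : IsShortExactSeq f g) {r : B ⟶ A} (hr : f ≫ r = 𝟙 A) :
    ∃ s : D ⟶ B, s ≫ g = 𝟙 D ∧ IsShortExactSeq s r := by
  have := h.epi
  obtain ⟨s, hs⟩ := h.exists_desc (𝟙 B - r ≫ f) (by simp [reassoc_of% hr])
  have hsg : s ≫ g = 𝟙 D := by
    rw [← cancel_epi g, ← Category.assoc, hs]
    simp [h.comp_eq_zero]
  have hsr : s ≫ r = 0 := by
    rw [← cancel_epi g, ← Category.assoc, hs]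
    simp [hr]
  have : Mono s := mono_of_mono_fac hsg
  have : Epi r := epi_of_epi_fac hr
  refine ⟨s, hsg, of_lift hsr fun T k hk => ⟨k ≫ g, ?_⟩⟩
  rw [Category.assoc, hs]
  simp [reassoc_of% hk]

end IsShortExactSeq

end ShortExact

section Ext

theorem IsShortExactSeq.exists_retraction {A B D : C} {f : A ⟶ B} {g : B ⟶ D}
    (h : IsShortExactSeq f g) (hext : Subsingleton (Abelian.Ext.{w} D A 1)) :
    ∃ r : B ⟶ A, f ≫ r = 𝟙 A := by
  obtain ⟨w, hS⟩ := h
  obtain ⟨x, hx⟩ := Abelian.Ext.contravariant_sequence_exact₁ hS A (Abelian.Ext.mk₀ (𝟙 A))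
    (add_zero 1) (Subsingleton.elim _ _)
  obtain ⟨r, rfl⟩ := Abelian.Ext.addEquiv₀.symm.surjective x
  refine ⟨r, ?_⟩
  apply Abelian.Ext.addEquiv₀.symm.injective
  simpa using hx

theorem ext_subsingleton_middle_right {A B D : C} {f : A ⟶ B} {g : B ⟶ D}
    (h : IsShortExactSeq f g) {X : C} {n : ℕ} (hA : Subsingleton (Abelian.Ext.{w} X A n))
    (hD : Subsingleton (Abelian.Ext.{w} X D n)) : Subsingleton (Abelian.Ext.{w} X B n) := by
  obtain ⟨w, hS⟩ := h
  refine subsingleton_of_forall_eq 0 fun x => ?_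
  obtain ⟨y, rfl⟩ := Abelian.Ext.covariant_sequence_exact₂ X hS x (Subsingleton.elim _ _)
  rw [Subsingleton.elim y 0, Abelian.Ext.zero_comp]

theorem ext_subsingleton_cokernel_right {A B D : C} {f : A ⟶ B} {g : B ⟶ D}
    (h : IsShortExactSeq f g) {X : C} {n : ℕ} (hB : Subsingleton (Abelian.Ext.{w} X B n))
    (hA : Subsingleton (Abelian.Ext.{w} X A (n + 1))) : Subsingleton (Abelian.Ext.{w} X D n) := by
  obtain ⟨w, hS⟩ := h
  refine subsingleton_of_forall_eq 0 fun x => ?_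
  obtain ⟨y, rfl⟩ := Abelian.Ext.covariant_sequence_exact₃ X hS x rfl (Subsingleton.elim _ _)
  rw [Subsingleton.elim y 0, Abelian.Ext.zero_comp]

theorem ext_subsingleton_kernel_left {A B D : C} {f : A ⟶ B} {g : B ⟶ D}
    (h : IsShortExactSeq f g) {Y : C} {n : ℕ} (hB : Subsingleton (Abelian.Ext.{w} B Y n))
    (hD : Subsingleton (Abelian.Ext.{w} D Y (1 + n))) : Subsingleton (Abelian.Ext.{w} A Y n) := by
  obtain ⟨w, hS⟩ := h
  refine subsingleton_of_forall_eq 0 fun x => ?_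
  obtain ⟨y, rfl⟩ := Abelian.Ext.contravariant_sequence_exact₁ hS Y x rfl (Subsingleton.elim _ _)
  rw [Subsingleton.elim y 0, Abelian.Ext.comp_zero]

/-- If `Ext^i(W, X)` vanishes for all `X ∈ XX` and `i > 0`, it vanishes on `XX^∧` as well. -/
theorem ext_subsingleton_of_hasResolutionLength {XX : Set C} {W : C}
    (hW : ∀ X ∈ XX, ∀ i : ℕ, 0 < i → Subsingleton (Abelian.Ext.{w} W X i)) {n : ℕ} {M : C}
    (hM : HasResolutionLength XX n M) :
    ∀ i : ℕ, 0 < i → Subsingleton (Abelian.Ext.{w} W M i) := by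
  induction hM with
  | zero hX e =>
    intro i hi
    refine subsingleton_of_forall_eq 0 fun x => ?_
    have := hW _ hX i hi
    rw [← x.comp_mk₀_id, ← e.inv_hom_id, ← Abelian.Ext.mk₀_comp_mk₀,
      ← Abelian.Ext.comp_assoc_of_third_deg_zero,
      Subsingleton.elim (x.comp (Abelian.Ext.mk₀ e.inv) _) 0, Abelian.Ext.zero_comp]
  | succ K X hX f p hse _ ih =>
    exact fun i hi => ext_subsingleton_cokernel_right hse (hW X hX i hi) (ih _ (Nat.succ_pos i))

end Ext

section Resolution

variable {𝒜 : Type u} [Category.{v} 𝒜] {XX ωω : Set 𝒜}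

theorem ClosedUnderSummands.mem_of_iso (h : ClosedUnderSummands XX) {A B : 𝒜} (hA : A ∈ XX)
    (e : A ≅ B) : B ∈ XX :=
  h hA e.inv e.hom e.inv_hom_id

variable [Abelian 𝒜]

theorem ClosedUnderSummands.zero_mem (h : ClosedUnderSummands XX) {A : 𝒜} (hA : A ∈ XX) :
    (0 : 𝒜) ∈ XX :=
  h hA 0 0 ((isZero_zero 𝒜).eq_of_src _ _)

theorem subset_resHat (XX : Set 𝒜) : XX ⊆ resHat XX :=
  fun M hM => ⟨0, .zero hM (Iso.refl M)⟩

theorem HasResolutionLength.mono (h : ωω ⊆ XX) {n : ℕ} {M : 𝒜}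
    (hM : HasResolutionLength ωω n M) : HasResolutionLength XX n M := by
  induction hM with
  | zero hX e => exact .zero (h hX) e
  | succ K X hX i p hse _ ih => exact .succ K X (h hX) i p hse ih

theorem resHat_mono (h : ωω ⊆ XX) : resHat ωω ⊆ resHat XX :=
  fun _ ⟨n, hM⟩ => ⟨n, hM.mono h⟩

theorem HasResolutionLength.nonempty {n : ℕ} {M : 𝒜} (hM : HasResolutionLength XX n M) :
    XX.Nonempty := by
  cases hM with
  | zero hX e => exact ⟨_, hX⟩
  | succ K X hX i p hse _ => exact ⟨_, hX⟩

theorem mem_resHat_of_shortExact {K X M : 𝒜} {i : K ⟶ X} {p : X ⟶ M} (h : IsShortExactSeq i p)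
    (hK : K ∈ resHat XX) (hX : X ∈ XX) : M ∈ resHat XX :=
  hK.elim fun n hn => ⟨n + 1, .succ K X hX i p h hn⟩

theorem HasResolutionLength.succ_length (hsum : ClosedUnderSummands XX) {n : ℕ} {M : 𝒜}
    (hM : HasResolutionLength XX n M) : HasResolutionLength XX (n + 1) M := by
  induction hM with
  | @zero M X hX e =>
    exact .succ 0 M (hsum.mem_of_iso hX e) _ _ (.of_zero_left M)
      (.zero (hsum.zero_mem hX) (Iso.refl _))
  | succ K X hX i p hse _ ih => exact .succ K X hX i p hse ih

theorem HasResolutionLength.of_le (hsum : ClosedUnderSummands XX) {m n : ℕ} (hmn : m ≤ n) {M : 𝒜}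
    (hM : HasResolutionLength XX m M) : HasResolutionLength XX n M := by
  induction hmn with
  | refl => exact hM
  | step _ ih => exact ih.succ_length hsum

/-- An extension of an object with an `XX`-resolution by an object of `XX` has an
`XX`-resolution of the same length. -/
theorem HasResolutionLength.of_extension (hext : ClosedUnderExtensions XX)
    (hsum : ClosedUnderSummands XX) {X L K : 𝒜} {f : X ⟶ L} {g : L ⟶ K}
    (h : IsShortExactSeq f g) (hX : X ∈ XX) {n : ℕ} (hK : HasResolutionLength XX n K) :
    HasResolutionLength XX n L := by
  cases hK with
  | zero hY e => exact .zero (hext f g h hX (hsum.mem_of_iso hY e)) (Iso.refl _)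
  | succ K' Y hY i p hse hK' =>
    obtain ⟨E, k, q, f', q', h₁, h₂⟩ := h.exists_pullback hse
    exact .succ K' E (hext f' q' h₂ hX hY) k q h₁ hK'

end Resolution

section FrobeniusPair

variable {XX ωω : Set C}

namespace LeftFrobeniusPair

theorem mem_of_ext_subsingleton (h : LeftFrobeniusPair.{w} XX ωω) {M : C} (hM : M ∈ XX)
    (hext : ∀ X ∈ XX, Subsingleton (Abelian.Ext.{w} X M 1)) : M ∈ ωω := by
  obtain ⟨W, X', i, p, hW, hX', hse⟩ := h.relCogen.2 M hM
  obtain ⟨r, hr⟩ := hse.exists_retraction (hext X' hX')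
  exact h.summands hW i r hr

theorem closedUnderExtensions (h : LeftFrobeniusPair.{w} XX ωω) : ClosedUnderExtensions ωω :=
  fun _ _ _ f g hse hA hD =>
    h.mem_of_ext_subsingleton (h.leftThick.1.1 f g hse (h.relCogen.1 hA) (h.relCogen.1 hD))
      fun X hX => ext_subsingleton_middle_right hse (h.relInj _ hA X hX 1 one_pos)
        (h.relInj _ hD X hX 1 one_pos)

theorem ext_subsingleton (h : LeftFrobeniusPair.{w} XX ωω) {X Y : C} (hX : X ∈ XX)
    (hY : Y ∈ resHat ωω) (i : ℕ) (hi : 0 < i) : Subsingleton (Abelian.Ext.{w} X Y i) :=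
  hY.elim fun _ hn =>
    ext_subsingleton_of_hasResolutionLength (fun W hW i hi => h.relInj W hW X hX i hi) hn i hi

theorem zero_mem_of_mem_resHat (h : LeftFrobeniusPair.{w} XX ωω) {M : C} (hM : M ∈ resHat XX) :
    (0 : C) ∈ ωω := by
  obtain ⟨n, hn⟩ := hM
  obtain ⟨X, hX⟩ := hn.nonempty
  obtain ⟨W, -, -, -, hW, -⟩ := h.relCogen.2 X hX
  exact h.summands.zero_mem hW

/-- The Auslander–Buchweitz approximations: special `XX`-precovers and special
`ωω^∧`-preenvelopes of objects of `XX^∧`. -/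
theorem exists_approximations (h : LeftFrobeniusPair.{w} XX ωω) {M : C} (hM : M ∈ resHat XX) :
    (∃ (Y X : C) (i : Y ⟶ X) (p : X ⟶ M), Y ∈ resHat ωω ∧ X ∈ XX ∧ IsShortExactSeq i p) ∧
    ∃ (Y X : C) (i : M ⟶ Y) (p : Y ⟶ X), Y ∈ resHat ωω ∧ X ∈ XX ∧ IsShortExactSeq i p := by
  have h0 := subset_resHat ωω (h.zero_mem_of_mem_resHat hM)
  obtain ⟨n, hn⟩ := hM
  induction hn with
  | @zero M X hX e =>
    have hM := h.leftThick.2.mem_of_iso hX e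
    obtain ⟨W, X', i, p, hW, hX', hse⟩ := h.relCogen.2 M hM
    exact ⟨⟨0, M, _, _, h0, hM, .of_zero_left M⟩, W, X', i, p, subset_resHat ωω hW, hX', hse⟩
  | succ K X₀ hX₀ j q hse _ ih =>
    obtain ⟨-, Y, X', i, p, hY, hX', hK⟩ := ih
    obtain ⟨E, b, p', a, q', h₁, h₂⟩ := hK.exists_pushout hse
    have hE : E ∈ XX := h.leftThick.1.1 b p' h₁ hX₀ hX'
    obtain ⟨W, X'', k, r, hW, hX'', hEW⟩ := h.relCogen.2 E hE
    obtain ⟨Z, s, t, u, h₃, h₄⟩ := h₂.exists_cokernel_comp hEW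
    exact ⟨⟨Y, E, a, q', hY, hE, h₂⟩, Z, X'', s, t, mem_resHat_of_shortExact h₄ hY hW, hX'', h₃⟩

theorem mem_resHat_iff (h : LeftFrobeniusPair.{w} XX ωω) {M : C} :
    M ∈ resHat ωω ↔
      M ∈ resHat XX ∧ ∀ X ∈ XX, Subsingleton (Abelian.Ext.{w} X M 1) := by
  refine ⟨fun hM => ⟨resHat_mono h.relCogen.1 hM,
    fun X hX => h.ext_subsingleton hX hM 1 one_pos⟩, fun ⟨hM, hext⟩ => ?_⟩
  obtain ⟨Y, X, i, p, hY, hX, hse⟩ := (h.exists_approximations hM).1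
  exact mem_resHat_of_shortExact hse hY (h.mem_of_ext_subsingleton hX fun X' hX' =>
    ext_subsingleton_middle_right hse (h.ext_subsingleton hX' hY 1 one_pos) (hext X' hX'))

theorem mem_iff (h : LeftFrobeniusPair.{w} XX ωω) {M : C} :
    M ∈ XX ↔ M ∈ resHat XX ∧ ∀ Y ∈ resHat ωω, Subsingleton (Abelian.Ext.{w} M Y 1) := by
  refine ⟨fun hM => ⟨subset_resHat XX hM, fun Y hY => h.ext_subsingleton hM hY 1 one_pos⟩,
    fun ⟨hM, hext⟩ => ?_⟩
  obtain ⟨Y, X, i, p, hY, hX, hse⟩ := (h.exists_approximations hM).1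
  obtain ⟨r, hr⟩ := hse.exists_retraction (hext Y hY)
  obtain ⟨s, hs, -⟩ := hse.exists_section_of_retraction hr
  exact h.leftThick.2 hX s p hs

theorem isCotorsionPair (h : LeftFrobeniusPair.{w} XX ωω) :
    IsCotorsionPair.{w} (resHat XX) XX (resHat ωω) := by
  refine ⟨⟨subset_resHat XX, resHat_mono h.relCogen.1, Set.ext fun M => h.mem_iff,
    fun M hM => (h.exists_approximations hM).1⟩, subset_resHat XX, resHat_mono h.relCogen.1,
    Set.ext fun M => h.mem_resHat_iff, fun M hM => (h.exists_approximations hM).2⟩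

end LeftFrobeniusPair

namespace StrongLeftFrobeniusPair

theorem ext_subsingleton_resHat (h : StrongLeftFrobeniusPair.{w} XX ωω) {W M : C} (hW : W ∈ ωω)
    (hM : M ∈ resHat XX) (i : ℕ) (hi : 0 < i) : Subsingleton (Abelian.Ext.{w} W M i) :=
  hM.elim fun _ hn => ext_subsingleton_of_hasResolutionLength (h.relProj W hW) hn i hi

theorem exists_cover (h : StrongLeftFrobeniusPair.{w} XX ωω) {M : C} {n : ℕ}
    (hM : HasResolutionLength XX (n + 1) M) :
    ∃ (L W : C) (i : L ⟶ W) (p : W ⟶ M),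
      HasResolutionLength XX n L ∧ W ∈ ωω ∧ IsShortExactSeq i p := by
  cases hM with
  | succ K X hX j q hse hK =>
    obtain ⟨X', W, i, p, hW, hX', hp⟩ := h.relGen.2 X hX
    obtain ⟨E, c, r, k, h₁, h₂⟩ := hp.exists_kernel_comp hse
    exact ⟨E, W, k, _, .of_extension h.leftThick.1.1 h.leftThick.2 h₁ hX' hK, hW, h₂⟩

theorem hasResolutionLength_of_extension (h : StrongLeftFrobeniusPair.{w} XX ωω) {n : ℕ}
    {A B D : C} {f : A ⟶ B} {g : B ⟶ D} (hse : IsShortExactSeq f g)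
    (hA : HasResolutionLength XX n A) (hD : HasResolutionLength XX n D) :
    HasResolutionLength XX n B := by
  induction n generalizing A B D with
  | zero =>
    cases hA with
    | zero hX e =>
      exact .of_extension h.leftThick.1.1 h.leftThick.2 hse (h.leftThick.2.mem_of_iso hX e) hD
  | succ n ih =>
    obtain ⟨LA, WA, iA, pA, hLA, hWA, hcA⟩ := h.exists_cover hA
    obtain ⟨LD, WD, iD, pD, hLD, hWD, hcD⟩ := h.exists_cover hD
    obtain ⟨E, k, q, f', q', h₁, h₂⟩ := hse.exists_pullback hcD
    obtain ⟨r, hr⟩ := h₂.exists_retraction (h.ext_subsingleton_resHat hWD ⟨_, hA⟩ 1 one_pos)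
    obtain ⟨s, -, hs⟩ := h₂.exists_section_of_retraction hr
    obtain ⟨F, k', t, s', t', h₃, h₄⟩ := hs.exists_pullback hcA
    obtain ⟨L, c, d, j, h₅, h₆⟩ := h₃.exists_kernel_comp h₁
    exact .succ L F (h.relCogen.1 (h.closedUnderExtensions s' t' h₄ hWD hWA)) j _ h₆
      (ih h₅ hLA hLD)

theorem isPrecoresolving_resHat (h : StrongLeftFrobeniusPair.{w} XX ωω) :
    IsPrecoresolving (resHat XX) := by
  have hext : ClosedUnderExtensions (resHat XX) := fun _ _ _ f g hse ⟨m, hA⟩ ⟨n, hD⟩ =>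
    ⟨max m n, h.hasResolutionLength_of_extension hse (hA.of_le h.leftThick.2 (le_max_left _ _))
      (hD.of_le h.leftThick.2 (le_max_right _ _))⟩
  refine ⟨hext, fun A B D f g hse hA ⟨n, hB⟩ => ?_⟩
  obtain ⟨L, W, i, p, hL, hW, hc⟩ := h.exists_cover (hB.succ_length h.leftThick.2)
  obtain ⟨E, c, r, k, h₁, h₂⟩ := hc.exists_kernel_comp hse
  exact mem_resHat_of_shortExact h₂ (hext c r h₁ ⟨n, hL⟩ hA) (h.relCogen.1 hW)

theorem isPrecoresolving_resHat_cogenerator (h : StrongLeftFrobeniusPair.{w} XX ωω) :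
    IsPrecoresolving (resHat ωω) := by
  have hS := h.isPrecoresolving_resHat
  refine ⟨fun A B D f g hse hA hD => ?_, fun A B D f g hse hA hB => ?_⟩
  · have hA' := h.mem_resHat_iff.1 hA
    have hD' := h.mem_resHat_iff.1 hD
    exact h.mem_resHat_iff.2 ⟨hS.1 f g hse hA'.1 hD'.1, fun X hX =>
      ext_subsingleton_middle_right hse (hA'.2 X hX) (hD'.2 X hX)⟩
  · have hA' := h.mem_resHat_iff.1 hA
    have hB' := h.mem_resHat_iff.1 hB
    exact h.mem_resHat_iff.2 ⟨hS.2 f g hse hA'.1 hB'.1, fun X hX =>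
      ext_subsingleton_cokernel_right hse (hB'.2 X hX) (h.ext_subsingleton hX hA 2 two_pos)⟩

theorem mem_of_ext_subsingleton_left (h : StrongLeftFrobeniusPair.{w} XX ωω) {M : C}
    (hM : M ∈ XX) (hext : ∀ X ∈ XX, Subsingleton (Abelian.Ext.{w} M X 1)) : M ∈ ωω := by
  obtain ⟨X', W, i, p, hW, hX', hse⟩ := h.relGen.2 M hM
  obtain ⟨r, hr⟩ := hse.exists_retraction (hext X' hX')
  obtain ⟨s, hs, -⟩ := hse.exists_section_of_retraction hr
  exact h.summands hW s p hs

theorem isPreresolving (h : StrongLeftFrobeniusPair.{w} XX ωω) : IsPreresolving ωω :=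
  ⟨h.closedUnderExtensions, fun _ _ _ f g hse hB hD =>
    h.mem_of_ext_subsingleton_left
      (h.leftThick.1.2 f g hse (h.relCogen.1 hB) (h.relCogen.1 hD))
      fun X hX => ext_subsingleton_kernel_left hse (h.relProj _ hB X hX 1 one_pos)
        (h.relProj _ hD X hX 2 two_pos)⟩

theorem mem_of_projective (h : StrongLeftFrobeniusPair.{w} XX ωω) {P : C} [Projective P]
    (hP : P ∈ XX) : P ∈ ωω := by
  obtain ⟨X', W, i, p, hW, hX', hse⟩ := h.relGen.2 P hP
  have := hse.epi
  exact h.summands hW (Projective.factorThru (𝟙 P) p) p (Projective.factorThru_comp _ _)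

theorem isCotorsionPair_resHat (h : StrongLeftFrobeniusPair.{w} XX ωω) :
    IsCotorsionPair.{w} (resHat XX) ωω (resHat XX) := by
  have hω : ωω ⊆ resHat XX := h.relCogen.1.trans (subset_resHat XX)
  have hcover : ∀ M ∈ resHat XX, ∃ (L W : C) (i : L ⟶ W) (p : W ⟶ M),
      L ∈ resHat XX ∧ W ∈ ωω ∧ IsShortExactSeq i p := fun M ⟨n, hM⟩ => by
    obtain ⟨L, W, i, p, hL, hW, hse⟩ := h.exists_cover (hM.succ_length h.leftThick.2)
    exact ⟨L, W, i, p, ⟨n, hL⟩, hW, hse⟩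
  refine ⟨⟨hω, subset_rfl, Set.ext fun M => ⟨fun hM => ⟨hω hM, fun Y hY =>
    h.ext_subsingleton_resHat hM hY 1 one_pos⟩, fun ⟨hM, hext⟩ => ?_⟩, hcover⟩,
    hω, subset_rfl, Set.ext fun M => ⟨fun hM => ⟨hM, fun W hW =>
    h.ext_subsingleton_resHat hW hM 1 one_pos⟩, And.left⟩, fun M hM =>
    ⟨M, 0, _, _, hM, h.zero_mem_of_mem_resHat hM, .of_zero_right M⟩⟩
  obtain ⟨L, W, i, p, hL, hW, hse⟩ := hcover M hM
  obtain ⟨r, hr⟩ := hse.exists_retraction (hext L hL)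
  obtain ⟨s, hs, -⟩ := hse.exists_section_of_retraction hr
  exact h.summands hW s p hs

end StrongLeftFrobeniusPair

end FrobeniusPair

/-- Theorem on hereditary induced pairs. For a strong left
Frobenius pair `(X,ω)`, the following are equivalent: (a) `Proj(C) ⊆ ω` and
`Inj(C) ⊆ X^∧`; (b) `(ω, X^∧)` is an `X^∧`-cotorsion pair with `ω` resolving in `C`
and `X^∧` coresolving in `C`; (c) `(X, ω^∧)` is an `X^∧`-cotorsion pair with `X`
resolving in `C` and `ω^∧` coresolving in `C`. -/
theorem stmt17 (XX ωω : Set C) (hfrob : StrongLeftFrobeniusPair XX ωω) :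
    ((ProjClass C ⊆ ωω ∧ InjClass C ⊆ resHat XX) ↔
      (IsCotorsionPair (resHat XX) ωω (resHat XX) ∧
        IsResolvingClass ωω ∧ IsCoresolvingClass (resHat XX))) ∧
    ((ProjClass C ⊆ ωω ∧ InjClass C ⊆ resHat XX) ↔
      (IsCotorsionPair (resHat XX) XX (resHat ωω) ∧
        IsResolvingClass XX ∧ IsCoresolvingClass (resHat ωω))) := by
  refine ⟨⟨fun ⟨hP, hI⟩ => ⟨hfrob.isCotorsionPair_resHat, ⟨hfrob.isPreresolving, hP⟩,
    hfrob.isPrecoresolving_resHat, hI⟩, fun ⟨_, hω, hS⟩ => ⟨hω.2, hS.2⟩⟩,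
    fun ⟨hP, hI⟩ => ⟨hfrob.isCotorsionPair, ⟨hfrob.leftThick.1, hP.trans hfrob.relCogen.1⟩,
      hfrob.isPrecoresolving_resHat_cogenerator, fun I hI' => ?_⟩,
    fun ⟨_, hX, hω⟩ => ⟨fun P hP => ?_, hω.2.trans (resHat_mono hfrob.relCogen.1)⟩⟩
  · have : Injective I := hI'
    exact hfrob.mem_resHat_iff.2 ⟨hI hI', fun X _ =>
      Abelian.Ext.subsingleton_of_injective X I 0⟩
  · have : Projective P := hP
    exact hfrob.mem_of_projective (hX.2 hP)

end ABFormal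
end

section
/- Let C be an abelian category, S a thick class of objects of C, and (F,G) a left S-cotorsion pair in C such that id_F(G) = 0 (i.e. Ext^i_C(F,G) = 0 for all F ∈ F, G ∈ G, and i ≥ 1). Then F is left thick, i.e. F is closed under extensions, under kernels of epimorphisms between objects of F, and under direct summands in C. -/
/-!
Common definitions for Auslander–Buchweitz approximation theory in abelian
categories, following Becerril–Mendoza–Pérez–Santiago.
-/

open CategoryTheory CategoryTheory.Limits ZeroObject

universe w v u

namespace ABFormal

variable {C : Type u} [Category.{v} C] [Abelian C] [CategoryTheory.HasExt.{w} C]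

open Abelian

/-- In a short exact sequence, `Ext^n(-, Y)` of the middle term vanishes as soon as it vanishes
on both ends. -/
lemma IsShortExactSeq.subsingleton_ext_middle {A B D : C} {f : A ⟶ B} {g : B ⟶ D}
    (h : IsShortExactSeq f g) (Y : C) (n : ℕ) [Subsingleton (Ext.{w} A Y n)]
    [Subsingleton (Ext.{w} D Y n)] : Subsingleton (Ext.{w} B Y n) := by
  obtain ⟨_, hse⟩ := h
  refine subsingleton_of_forall_eq 0 fun x => ?_
  obtain ⟨y, rfl⟩ := Ext.contravariant_sequence_exact₂ hse Y x
    (Subsingleton.elim (α := Ext.{w} A Y n) _ _)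
  rw [show y = 0 from Subsingleton.elim (α := Ext.{w} D Y n) _ _, Ext.comp_zero]

/-- In a short exact sequence, `Ext^n(-, Y)` of the left term vanishes as soon as `Ext^n(-, Y)`
vanishes on the middle term and `Ext^{n+1}(-, Y)` vanishes on the right term. -/
lemma IsShortExactSeq.subsingleton_ext_left {A B D : C} {f : A ⟶ B} {g : B ⟶ D}
    (h : IsShortExactSeq f g) (Y : C) (n : ℕ) [Subsingleton (Ext.{w} B Y n)]
    [Subsingleton (Ext.{w} D Y (1 + n))] : Subsingleton (Ext.{w} A Y n) := by
  obtain ⟨_, hse⟩ := h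
  refine subsingleton_of_forall_eq 0 fun x => ?_
  obtain ⟨y, rfl⟩ := Ext.contravariant_sequence_exact₁ hse Y x rfl
    (Subsingleton.elim (α := Ext.{w} D Y (1 + n)) _ _)
  rw [show y = 0 from Subsingleton.elim (α := Ext.{w} B Y n) _ _, Ext.comp_zero]

/-- Vanishing of `Ext^n(-, Y)` passes to retracts. -/
lemma subsingleton_ext_of_retract {A X : C} (s : A ⟶ X) (r : X ⟶ A) (hsr : s ≫ r = 𝟙 A)
    (Y : C) (n : ℕ) [Subsingleton (Ext.{w} X Y n)] : Subsingleton (Ext.{w} A Y n) := by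
  refine subsingleton_of_forall_eq 0 fun x => ?_
  rw [← Ext.mk₀_id_comp x, ← hsr, ← Ext.mk₀_comp_mk₀_assoc,
    Subsingleton.elim ((Ext.mk₀ r).comp x (zero_add n)) 0, Ext.comp_zero]

/-- Lemma on left thickness. If `(F,G)` is a left `S`-cotorsion
pair with `id_F(G) = 0` (i.e. `Ext^i(F,G) = 0` for all `i ≥ 1`), then `F` is left
thick. -/
theorem stmt18 (S F G : Set C) (hS : IsThickClass S)
    (hpair : IsLeftCotorsionPair S F G) (hid : IsRelInjective F G) :
    IsLeftThick F := by
  obtain ⟨-, -, hF, -⟩ := hpair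
  obtain ⟨⟨⟨hSext, hSker⟩, hSsum⟩, -⟩ := hS
  have mem_iff (A : C) : A ∈ F ↔ A ∈ S ∧ ∀ Y ∈ G, Subsingleton (Ext.{w} A Y 1) :=
    Set.ext_iff.mp hF A
  refine ⟨⟨fun A B D f g h hA hD => ?_, fun A B D f g h hB hD => ?_⟩,
    fun X A hX s r hsr => ?_⟩
  · obtain ⟨hAS, hA⟩ := (mem_iff A).mp hA
    obtain ⟨hDS, hD⟩ := (mem_iff D).mp hD
    refine (mem_iff B).mpr ⟨hSext f g h hAS hDS, fun Y hY => ?_⟩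
    have := hA Y hY
    have := hD Y hY
    exact h.subsingleton_ext_middle Y 1
  · refine (mem_iff A).mpr
      ⟨hSker f g h ((mem_iff B).mp hB).1 ((mem_iff D).mp hD).1, fun Y hY => ?_⟩
    have := hid Y hY B hB 1 one_pos
    have := hid Y hY D hD (1 + 1) two_pos
    exact h.subsingleton_ext_left Y 1
  · obtain ⟨hXS, hX⟩ := (mem_iff X).mp hX
    refine (mem_iff A).mpr ⟨hSsum hXS s r hsr, fun Y hY => ?_⟩
    have := hX Y hY
    exact subsingleton_ext_of_retract s r hsr Y 1

end ABFormal
end
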